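/- arXiv:2605.26808 — 12 statements merged into one kernel-verified Lean document; each statement's English description precedes it below -/
import Mathlib

section
/- Assume K-sparsity and Regular Facts, and suppose U is nonempty. If g(U) > 0, then ν({F ⊆ Ω : g(Ω \ F) > 0}) ≥ 1 − K/|U|. (Innovation implies hallucination with high probability.) -/
open MeasureTheory

/-- **Innovation implies hallucination with high probability.**
`Ω` is a finite nonempty set, `O` the observed statements, `U := Oᶜ ≠ ∅` the
unobserved statements, `ν` a probability measure on the subsets of `Ω`
(representing sets of facts), satisfying `K`-sparsity (ν-a.s. `|F| ≤ K`) and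
Regular Facts. If the probability distribution `g` innovates, i.e. `g(U) > 0`,
then `ν({F : g(Ω \ F) > 0}) ≥ 1 − K/|U|`. -/
theorem innovation_implies_hallucination
    {Ω : Type*} [Fintype Ω] [DecidableEq Ω] [Nonempty Ω]
    [MeasurableSpace (Finset Ω)] [MeasurableSingletonClass (Finset Ω)]
    (O : Finset Ω) (hU : (Oᶜ : Finset Ω).Nonempty)
    (ν : Measure (Finset Ω)) [IsProbabilityMeasure ν]
    (K : ℕ) (hK : 0 < K)
    (hsparse : ∀ᵐ F ∂ν, F.card ≤ K)
    (hreg : ∀ y ∈ (Oᶜ : Finset Ω), ∀ y' ∈ (Oᶜ : Finset Ω),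
      ν {F | y ∈ F} = ν {F | y' ∈ F})
    (g : Ω → ℝ) (hg0 : ∀ y, 0 ≤ g y) (hg1 : ∑ y, g y = 1)
    (hinn : 0 < ∑ y ∈ Oᶜ, g y) :
    (1 : ℝ) - (K : ℝ) / (Oᶜ : Finset Ω).card ≤
      (ν {F | 0 < ∑ y ∈ Fᶜ, g y}).toReal := by
  obtain ⟨y, hy, hgy⟩ : ∃ y ∈ Oᶜ, 0 < g y := by
    by_contra! h
    exact absurd (Finset.sum_nonpos h) (not_le.mpr hinn)
  have hmeas : ∀ S : Set (Finset Ω), MeasurableSet S := fun S => (Set.toFinite S).measurableSet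
  have hsum : ((Oᶜ : Finset Ω).card : ENNReal) * ν {F | y ∈ F} ≤ (K : ENNReal) := by
    calc ((Oᶜ : Finset Ω).card : ENNReal) * ν {F | y ∈ F}
        = ∑ z ∈ Oᶜ, ν {F | z ∈ F} := by
          rw [Finset.sum_congr rfl (fun z hz => hreg z hz y hy)]
          simp
      _ = ∑ z ∈ Oᶜ, ∫⁻ F, Set.indicator {F : Finset Ω | z ∈ F} 1 F ∂ν := by
          refine Finset.sum_congr rfl fun z _ => ?_
          rw [lintegral_indicator_one (hmeas _)]
      _ = ∫⁻ F, ∑ z ∈ Oᶜ, Set.indicator {F : Finset Ω | z ∈ F} 1 F ∂ν := by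
          rw [lintegral_finsetSum]
          intro z _
          exact fun s _ => hmeas _
      _ ≤ ∫⁻ _, (K : ENNReal) ∂ν := by
          refine lintegral_mono_ae ?_
          filter_upwards [hsparse] with F hF
          have : ∑ z ∈ Oᶜ, Set.indicator {F : Finset Ω | z ∈ F} (1 : Finset Ω → ENNReal) F
              = ((Oᶜ.filter (fun z => z ∈ F)).card : ENNReal) := by
            simp only [Set.indicator_apply, Set.mem_setOf_eq, Pi.one_apply, Finset.sum_boole]
          rw [this]
          have h2 : (Oᶜ.filter (fun z => z ∈ F)).card ≤ F.card :=
            Finset.card_le_card fun z hz => (Finset.mem_filter.mp hz).2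
          exact_mod_cast h2.trans hF
      _ = K := by simp
  have hc : (0 : ℝ) < (Oᶜ : Finset Ω).card := by exact_mod_cast hU.card_pos
  have hr : ((Oᶜ : Finset Ω).card : ℝ) * ν.real {F | y ∈ F} ≤ K := by
    have := ENNReal.toReal_mono (ENNReal.natCast_ne_top K) hsum
    rw [ENNReal.toReal_mul] at this
    simpa only [ENNReal.toReal_natCast, Measure.real] using this
  have hle : ν.real {F | y ∈ F} ≤ (K : ℝ) / (Oᶜ : Finset Ω).card := by
    rw [le_div_iff₀ hc]; linarith
  have hcompl : ν.real {F | y ∈ F}ᶜ = 1 - ν.real {F | y ∈ F} :=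
    probReal_compl_eq_one_sub (hmeas _)
  have hsub : ν.real {F | y ∈ F}ᶜ ≤ ν.real {F | 0 < ∑ y ∈ Fᶜ, g y} := by
    refine measureReal_mono ?_
    intro F hF
    have hF' : y ∈ Fᶜ := Finset.mem_compl.mpr hF
    exact lt_of_lt_of_le hgy (Finset.single_le_sum (fun z _ => hg0 z) hF')
  change _ ≤ ν.real _
  linarith
end

section
/- Assume K-sparsity and Regular Facts, that ν-almost surely O ⊆ F, and that U is nonempty. Then for every δ with K/|U| < δ < 1: ν({F ⊆ Ω : g(Ω \ F) ≥ g(U)·(1 − K/(δ·|U|))}) ≥ 1 − δ. (Markov-style lower bound on the hallucination rate via the innovation rate.) -/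
open MeasureTheory

/-- **Markov-style lower bound on the hallucination rate via the innovation rate.**
Under `K`-sparsity and Regular Facts, with all observed statements ν-a.s.
factual and `U := Oᶜ` nonempty, for every `δ ∈ (K/|U|, 1)`:
`ν({F : g(Ω \ F) ≥ g(U)·(1 − K/(δ·|U|))}) ≥ 1 − δ`. -/
theorem markov_style_bound
    {Ω : Type*} [Fintype Ω] [DecidableEq Ω] [Nonempty Ω]
    [MeasurableSpace (Finset Ω)] [MeasurableSingletonClass (Finset Ω)]
    (O : Finset Ω) (hU : (Oᶜ : Finset Ω).Nonempty)
    (ν : Measure (Finset Ω)) [IsProbabilityMeasure ν]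
    (K : ℕ) (hK : 0 < K)
    (hsparse : ∀ᵐ F ∂ν, F.card ≤ K)
    (hO : ∀ᵐ F ∂ν, O ⊆ F)
    (hreg : ∀ y ∈ (Oᶜ : Finset Ω), ∀ y' ∈ (Oᶜ : Finset Ω),
      ν {F | y ∈ F} = ν {F | y' ∈ F})
    (g : Ω → ℝ) (hg0 : ∀ y, 0 ≤ g y) (hg1 : ∑ y, g y = 1)
    (δ : ℝ) (hδ₁ : (K : ℝ) / (Oᶜ : Finset Ω).card < δ) (hδ₂ : δ < 1) :
    (1 : ℝ) - δ ≤
      (ν {F | (∑ y ∈ Oᶜ, g y) * (1 - (K : ℝ) / (δ * (Oᶜ : Finset Ω).card)) ≤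
        ∑ y ∈ Fᶜ, g y}).toReal := by
  classical
  have hn : (0 : ℝ) < ((Oᶜ : Finset Ω).card : ℝ) := by exact_mod_cast hU.card_pos
  have hKr : (0 : ℝ) < (K : ℝ) := by exact_mod_cast hK
  have hδ0 : 0 < δ := lt_trans (div_pos hKr hn) hδ₁
  set n : ℝ := ((Oᶜ : Finset Ω).card : ℝ) with hndef
  set G : ℝ := ∑ y ∈ Oᶜ, g y with hG
  have hG0 : 0 ≤ G := Finset.sum_nonneg fun y _ => hg0 y
  obtain ⟨y₀, hy₀⟩ := hU
  set p : ℝ := ν.real {F | y₀ ∈ F} with hp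
  have hpy : ∀ y ∈ (Oᶜ : Finset Ω), ν.real {F | y ∈ F} = p := fun y hy => by
    simp only [hp, Measure.real, hreg y hy y₀ hy₀]
  have hint : ∀ w : Ω → ℝ,
      ∫ F, (∑ y ∈ Oᶜ, w y * Set.indicator {F : Finset Ω | y ∈ F} 1 F) ∂ν
        = (∑ y ∈ Oᶜ, w y) * p := by
    intro w
    rw [integral_finsetSum _ (fun y _ => Integrable.of_finite), Finset.sum_mul]
    refine Finset.sum_congr rfl fun y hy => ?_
    rw [integral_const_mul, integral_indicator_one (Set.toFinite _).measurableSet, hpy y hy]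
  have hnp : n * p ≤ K := by
    have h1 := hint (fun _ => 1)
    have h2 : ∫ F, (∑ y ∈ Oᶜ, (1 : ℝ) * Set.indicator {F : Finset Ω | y ∈ F} 1 F) ∂ν
        ≤ ∫ _F, (K : ℝ) ∂ν := by
      refine integral_mono_ae Integrable.of_finite Integrable.of_finite ?_
      filter_upwards [hsparse] with F hF
      have : (∑ y ∈ Oᶜ, (1 : ℝ) * Set.indicator {F : Finset Ω | y ∈ F} 1 F)
          = ((Oᶜ.filter (fun y => y ∈ F)).card : ℝ) := by
        simp [Set.indicator_apply]
        congr 1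
      rw [this]
      have h3 : (Oᶜ.filter (fun y => y ∈ F)).card ≤ F.card :=
        Finset.card_le_card fun y hy => (Finset.mem_filter.1 hy).2
      exact_mod_cast h3.trans hF
    rw [h1] at h2
    simpa [hndef] using h2
  set X : Finset Ω → ℝ :=
    fun F => ∑ y ∈ Oᶜ, g y * Set.indicator {F : Finset Ω | y ∈ F} 1 F with hX
  have hX0 : ∀ F, 0 ≤ X F := fun F => Finset.sum_nonneg fun y _ =>
    mul_nonneg (hg0 y) (Set.indicator_nonneg (fun _ _ => zero_le_one) _)
  have hkey : ∀ F : Finset Ω, G - X F ≤ ∑ y ∈ Fᶜ, g y := by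
    intro F
    have h1 : G - X F = ∑ y ∈ Oᶜ.filter (fun y => y ∉ F), g y := by
      rw [hG, hX, ← Finset.sum_sub_distrib, Finset.sum_filter]
      refine Finset.sum_congr rfl fun y _ => ?_
      by_cases h : y ∈ F <;> simp [h]
    rw [h1]
    refine Finset.sum_le_sum_of_subset_of_nonneg (fun y hy => ?_) fun y _ _ => hg0 y
    simpa using (Finset.mem_filter.1 hy).2
  set S : Set (Finset Ω) := {F | G * (1 - (K : ℝ) / (δ * n)) ≤ ∑ y ∈ Fᶜ, g y} with hS
  change 1 - δ ≤ ν.real S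
  set ε : ℝ := G * ((K : ℝ) / (δ * n)) with hε
  rcases hG0.eq_or_lt with h0 | hpos
  · have : S = Set.univ := by
      ext F
      simp only [hS, ← h0, zero_mul, Set.mem_setOf_eq, Set.mem_univ, iff_true]
      exact Finset.sum_nonneg fun y _ => hg0 y
    rw [this]
    simp [hδ0.le]
  · have hε0 : 0 < ε := by positivity
    have hM := mul_meas_ge_le_integral_of_nonneg (μ := ν) (f := X)
      (Filter.Eventually.of_forall hX0) Integrable.of_finite ε
    rw [hint g] at hM
    have h1 : G * p ≤ ε * δ := by
      have : ε * δ = G * (K / n) := by rw [hε]; field_simp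
      rw [this]
      refine mul_le_mul_of_nonneg_left ?_ hG0
      rw [le_div_iff₀ hn]; linarith
    have h2 : ν.real {F | ε ≤ X F} ≤ δ :=
      le_of_mul_le_mul_left (hM.trans h1) hε0
    have h3 : Sᶜ ⊆ {F | ε ≤ X F} := by
      intro F hF
      simp only [hS, Set.mem_compl_iff, Set.mem_setOf_eq, not_le] at hF ⊢
      have := hkey F
      have h4 : G * (1 - (K : ℝ) / (δ * n)) = G - ε := by rw [hε]; ring
      linarith
    have h4 : ν.real Sᶜ ≤ ν.real {F | ε ≤ X F} := measureReal_mono h3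
    rw [probReal_compl_eq_one_sub (Set.toFinite S).measurableSet] at h4
    linarith
end

section
/- Assume K-sparsity and Regular Facts, and suppose U is nonempty. Then ν({F ⊆ Ω : g(Ω \ F) ≥ g(U)/(K+1)}) ≥ 1 − K/|U|. (High-confidence lower bound on the hallucination rate via the innovation rate.) -/
open MeasureTheory

/-- **High-confidence lower bound on the hallucination rate via the innovation
rate.** Under `K`-sparsity and Regular Facts, with `U := Oᶜ` nonempty:
`ν({F : g(Ω \ F) ≥ g(U)/(K+1)}) ≥ 1 − K/|U|`. -/
theorem high_confidence_bound
    {Ω : Type*} [Fintype Ω] [DecidableEq Ω] [Nonempty Ω]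
    [MeasurableSpace (Finset Ω)] [MeasurableSingletonClass (Finset Ω)]
    (O : Finset Ω) (hU : (Oᶜ : Finset Ω).Nonempty)
    (ν : Measure (Finset Ω)) [IsProbabilityMeasure ν]
    (K : ℕ) (hK : 0 < K)
    (hsparse : ∀ᵐ F ∂ν, F.card ≤ K)
    (hreg : ∀ y ∈ (Oᶜ : Finset Ω), ∀ y' ∈ (Oᶜ : Finset Ω),
      ν {F | y ∈ F} = ν {F | y' ∈ F})
    (g : Ω → ℝ) (hg0 : ∀ y, 0 ≤ g y) (hg1 : ∑ y, g y = 1) :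
    (1 : ℝ) - (K : ℝ) / (Oᶜ : Finset Ω).card ≤
      (ν {F | (∑ y ∈ Oᶜ, g y) / ((K : ℝ) + 1) ≤ ∑ y ∈ Fᶜ, g y}).toReal := by
  classical
  have hm : ∀ S : Set (Finset Ω), MeasurableSet S := fun S => (Set.toFinite S).measurableSet
  obtain ⟨z, hz, hmax⟩ := Finset.exists_max_image (Oᶜ : Finset Ω) g hU
  have hsum : ∑ y ∈ Oᶜ, ν {F | y ∈ F} ≤ (K : ENNReal) := by
    have h1 : ∀ y : Ω, ν {F | y ∈ F} =
        ∫⁻ F, ({F : Finset Ω | y ∈ F}).indicator (fun _ => (1 : ENNReal)) F ∂ν := by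
      intro y
      rw [lintegral_indicator (hm _)]
      simp
    simp_rw [h1]
    rw [← lintegral_finsetSum' _ (fun y _ => (measurable_const.indicator (hm _)).aemeasurable)]
    calc _ ≤ ∫⁻ _F, (K : ENNReal) ∂ν := by
          apply lintegral_mono_ae
          filter_upwards [hsparse] with F hF
          simp only [Set.indicator_apply, Set.mem_setOf_eq, Finset.sum_boole]
          norm_cast
          refine le_trans (Finset.card_le_card ?_) hF
          intro y hy
          exact (Finset.mem_filter.1 hy).2
      _ = K := by simp
  have hp : ((Oᶜ : Finset Ω).card : ℝ) * ν.real {F | z ∈ F} ≤ K := by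
    rw [Finset.sum_congr rfl (fun y hy => hreg y hy z hz), Finset.sum_const, nsmul_eq_mul] at hsum
    have := ENNReal.toReal_mono (by simp) hsum
    simpa [ENNReal.toReal_mul, Measure.real] using this
  have hc : (0 : ℝ) < (Oᶜ : Finset Ω).card := by exact_mod_cast hU.card_pos
  have hp' : ν.real {F | z ∈ F} ≤ K / (Oᶜ : Finset Ω).card := by
    rw [le_div_iff₀ hc]; linarith
  have hcompl : ν.real ({F | z ∈ F}ᶜ) = 1 - ν.real {F | z ∈ F} :=
    probReal_compl_eq_one_sub (hm _)
  have hle : ν ({F | z ∈ F}ᶜ) ≤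
      ν {F | (∑ y ∈ Oᶜ, g y) / ((K : ℝ) + 1) ≤ ∑ y ∈ Fᶜ, g y} := by
    apply measure_mono_ae
    filter_upwards [hsparse] with F hF hzF
    have hzF : z ∉ F := hzF
    change (∑ y ∈ Oᶜ, g y) / ((K : ℝ) + 1) ≤ ∑ y ∈ Fᶜ, g y
    have hzle : g z ≤ ∑ y ∈ Fᶜ, g y :=
      Finset.single_le_sum (fun y _ => hg0 y) (Finset.mem_compl.2 hzF)
    have hsplit : ∑ y ∈ Oᶜ, g y = ∑ y ∈ Oᶜ ∩ F, g y + ∑ y ∈ Oᶜ \ F, g y :=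
      (Finset.sum_inter_add_sum_sdiff _ _ _).symm
    have h2 : ∑ y ∈ Oᶜ \ F, g y ≤ ∑ y ∈ Fᶜ, g y := by
      apply Finset.sum_le_sum_of_subset_of_nonneg
      · intro y hy
        exact Finset.mem_compl.2 (Finset.mem_sdiff.1 hy).2
      · intro y _ _
        exact hg0 y
    have h3 : ∑ y ∈ Oᶜ ∩ F, g y ≤ K * g z := by
      calc _ ≤ (Oᶜ ∩ F).card • g z :=
            Finset.sum_le_card_nsmul _ _ _ (fun y hy => hmax y (Finset.mem_inter.1 hy).1)
        _ = ((Oᶜ ∩ F).card : ℝ) * g z := nsmul_eq_mul _ _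
        _ ≤ K * g z := by
            apply mul_le_mul_of_nonneg_right _ (hg0 z)
            exact_mod_cast (Finset.card_le_card Finset.inter_subset_right).trans hF
    have h4 : (K : ℝ) * g z ≤ K * ∑ y ∈ Fᶜ, g y :=
      mul_le_mul_of_nonneg_left hzle (Nat.cast_nonneg K)
    rw [div_le_iff₀ (by positivity)]
    linarith
  have := ENNReal.toReal_mono (measure_ne_top ν _) hle
  simp only [Measure.real] at hcompl hp'
  linarith
end

section
/- Let p be a probability distribution on Ω with |supp(p)| ≤ K and O ⊆ supp(p), let Π be a partition of Ω, and let g be any probability distribution on Ω. Then g(U) ≥ p(U)/(K+1) − ‖g − p^Π‖_TV. (Missing mass lower-bounds the innovation rate.) -/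
/-- Total variation distance between two (finitely supported) distributions on a
finite type: `‖g − h‖_TV := max_{S ⊆ Ω} |g(S) − h(S)|`. -/
noncomputable def tvDist {Ω : Type*} [Fintype Ω] [DecidableEq Ω] (g h : Ω → ℝ) : ℝ :=
  Finset.univ.sup' ⟨∅, Finset.mem_univ ∅⟩
    (fun S : Finset Ω => |∑ y ∈ S, g y - ∑ y ∈ S, h y|)

/-- **Missing mass lower-bounds the innovation rate.**
Let `p` be a probability distribution on `Ω` with `|supp(p)| ≤ K` and
`O ⊆ supp(p)`, let the partition `Π` be given by its cell map `part`, and let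
`g` be any probability distribution.  Then
`g(U) ≥ p(U)/(K+1) − ‖g − p^Π‖_TV`, where `p^Π(y) = p(B_y)/|B_y|`. -/
theorem missing_mass_lower_bounds_innovation
    {Ω : Type*} [Fintype Ω] [DecidableEq Ω] [Nonempty Ω]
    (O : Finset Ω) (K : ℕ) (hK : 0 < K)
    (p : Ω → ℝ) (hp0 : ∀ y, 0 ≤ p y) (hp1 : ∑ y, p y = 1)
    (hsupp : (Finset.univ.filter fun y => 0 < p y).card ≤ K)
    (hO : O ⊆ Finset.univ.filter fun y => 0 < p y)
    (part : Ω → Finset Ω)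
    (hmem : ∀ y, y ∈ part y)
    (hcell : ∀ y z, z ∈ part y → part z = part y)
    (g : Ω → ℝ) (hg0 : ∀ y, 0 ≤ g y) (hg1 : ∑ y, g y = 1) :
    (∑ y ∈ Oᶜ, p y) / ((K : ℝ) + 1)
      - tvDist g (fun y => (∑ z ∈ part y, p z) / (part y).card)
      ≤ ∑ y ∈ Oᶜ, g y := by
  have htv : |∑ y ∈ Oᶜ, g y - ∑ y ∈ Oᶜ, (∑ z ∈ part y, p z) / ((part y).card : ℝ)|
      ≤ tvDist g (fun y => (∑ z ∈ part y, p z) / (part y).card) := by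
    unfold tvDist
    exact Finset.le_sup' (fun S : Finset Ω =>
      |∑ y ∈ S, g y - ∑ y ∈ S, (∑ z ∈ part y, p z) / ((part y).card : ℝ)|)
      (Finset.mem_univ Oᶜ)
  have key : (∑ y ∈ Oᶜ, p y) / ((K : ℝ) + 1)
      ≤ ∑ y ∈ Oᶜ, (∑ z ∈ part y, p z) / ((part y).card : ℝ) := by
    have hsymm : ∀ y z, z ∈ part y → y ∈ part z := by
      intro y z h
      rw [hcell y z h]
      exact hmem y
    have hOK : O.card ≤ K := (Finset.card_le_card hO).trans hsupp
    calc (∑ z ∈ Oᶜ, p z) / ((K : ℝ) + 1)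
        ≤ ∑ z ∈ Oᶜ, ∑ y ∈ Oᶜ, if z ∈ part y then p z / ((part y).card : ℝ) else 0 := by
          rw [Finset.sum_div]
          refine Finset.sum_le_sum fun z hz => ?_
          have h1 : (∑ y ∈ Oᶜ, if z ∈ part y then p z / ((part y).card : ℝ) else 0)
              = ∑ y ∈ Oᶜ, if y ∈ part z then p z / ((part z).card : ℝ) else 0 := by
            refine Finset.sum_congr rfl fun y _ => ?_
            by_cases h : z ∈ part y
            · rw [if_pos h, if_pos (hsymm y z h), hcell y z h]
            · rw [if_neg h, if_neg (fun h' => h (hsymm z y h'))]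
          rw [h1, ← Finset.sum_filter, Finset.sum_const, nsmul_eq_mul]
          set u := (Oᶜ.filter fun y => y ∈ part z).card with hu
          have hu1 : 1 ≤ u := Finset.card_pos.mpr ⟨z, by simp [hmem z, Finset.mem_compl.mp hz]⟩
          have hc : (part z).card ≤ u + O.card := by
            refine (Finset.card_le_card ?_).trans (Finset.card_union_le _ _)
            intro y hy
            by_cases h : y ∈ O <;> simp [h, hy]
          have hpos : 0 < (part z).card := Finset.card_pos.mpr ⟨z, hmem z⟩
          have hn : (part z).card ≤ u * (K + 1) := by nlinarith
          have hn' : ((part z).card : ℝ) ≤ u * ((K : ℝ) + 1) := by exact_mod_cast hn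
          have hpos' : (0 : ℝ) < (part z).card := by exact_mod_cast hpos
          rw [← mul_div_assoc, div_le_div_iff₀ (by positivity) hpos']
          nlinarith [mul_le_mul_of_nonneg_left hn' (hp0 z)]
      _ = ∑ y ∈ Oᶜ, ∑ z ∈ Oᶜ, if z ∈ part y then p z / ((part y).card : ℝ) else 0 :=
          Finset.sum_comm
      _ ≤ _ := by
          refine Finset.sum_le_sum fun y _ => ?_
          rw [← Finset.sum_filter, Finset.sum_div]
          refine Finset.sum_le_sum_of_subset_of_nonneg ?_ ?_
          · intro z hz
            exact (Finset.mem_filter.mp hz).2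
          · intro z _ _
            exact div_nonneg (hp0 z) (Nat.cast_nonneg _)
  have := (abs_le.mp htv).1
  linarith
end

section
/- Assume ν-almost surely |F(p)| ≤ K and O ⊆ F(p), assume Regular Facts (for all y, y' ∈ U, ν({p : y ∈ F(p)}) = ν({p : y' ∈ F(p)})), and suppose U is nonempty. Let Π be a measurable assignment p ↦ Π(p) of a partition of Ω to each distribution p. Then for every δ with K/|U| < δ < 1: ν({p : g(H(p)) ≥ p(U)/(K+1) − 1/(δ·|U|) − ‖g − p^{Π(p)}‖_TV}) ≥ 1 − δ. (Missing-mass lower bound from the Markov-style bound.) -/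
open MeasureTheory

theorem coarse_lower {Ω : Type*} [Fintype Ω] [DecidableEq Ω] (O : Finset Ω) (K : ℕ)
    (hOK : O.card ≤ K) (p : Ω → ℝ) (hp : ∀ y, 0 ≤ p y) (B : Ω → Finset Ω)
    (hmem : ∀ y, y ∈ B y) (hcell : ∀ y z, z ∈ B y → B z = B y) :
    (∑ y ∈ Oᶜ, p y) / ((K : ℝ) + 1) ≤ ∑ y ∈ Oᶜ, (∑ z ∈ B y, p z) / (B y).card := by
  have key : ∀ y z, z ∈ B y ↔ y ∈ B z := by
    intro y z
    constructor
    · intro h; rw [hcell y z h]; exact hmem y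
    · intro h; rw [hcell z y h]; exact hmem z
  have h1 : ∑ y ∈ Oᶜ, (∑ z ∈ B y, p z) / ((B y).card : ℝ)
      = ∑ z, ∑ y ∈ Oᶜ, if y ∈ B z then p z / ((B z).card : ℝ) else 0 := by
    rw [Finset.sum_comm]
    refine Finset.sum_congr rfl fun y _ => ?_
    rw [Finset.sum_div, ← Finset.sum_filter]
    have : (Finset.univ.filter fun z => y ∈ B z) = B y := by
      ext z; simp [key y z]
    rw [this]
    refine Finset.sum_congr rfl fun z hz => ?_
    rw [hcell y z hz]
  rw [h1, Finset.sum_div]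
  have hnn : ∀ z, 0 ≤ ∑ y ∈ Oᶜ, if y ∈ B z then p z / ((B z).card : ℝ) else 0 := by
    intro z
    refine Finset.sum_nonneg fun y _ => ?_
    split_ifs
    · exact div_nonneg (hp z) (Nat.cast_nonneg _)
    · exact le_rfl
  refine le_trans ?_ (Finset.sum_le_sum_of_subset_of_nonneg (Finset.subset_univ Oᶜ)
    fun z _ _ => hnn z)
  refine Finset.sum_le_sum fun z hz => ?_
  rw [← Finset.sum_filter, Finset.sum_const, nsmul_eq_mul]
  set j := (Oᶜ.filter fun y => y ∈ B z).card with hj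
  have hj1 : 1 ≤ j := Finset.card_pos.2 ⟨z, Finset.mem_filter.2 ⟨hz, hmem z⟩⟩
  have hb : (B z).card ≤ j + K := by
    have hsub : B z ⊆ (Oᶜ.filter fun y => y ∈ B z) ∪ O := by
      intro y hy
      by_cases h : y ∈ O <;> simp [h, hy]
    have := (Finset.card_le_card hsub).trans (Finset.card_union_le _ _)
    omega
  have hb0 : 0 < (B z).card := Finset.card_pos.2 ⟨z, hmem z⟩
  have hb' : ((B z).card : ℝ) ≤ j + K := by exact_mod_cast hb
  have hb0' : (0 : ℝ) < (B z).card := by exact_mod_cast hb0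
  have hj' : (1 : ℝ) ≤ j := by exact_mod_cast hj1
  have hK0 : (0 : ℝ) ≤ K := Nat.cast_nonneg K
  rw [← mul_div_assoc, div_le_div_iff₀ (by positivity) hb0']
  have : ((B z).card : ℝ) ≤ j * (K + 1) := by nlinarith
  nlinarith [mul_le_mul_of_nonneg_left this (hp z)]

theorem tv_ge {Ω : Type*} [Fintype Ω] [DecidableEq Ω] (g h : Ω → ℝ) (S : Finset Ω) :
    |∑ y ∈ S, g y - ∑ y ∈ S, h y| ≤ tvDist g h :=
  Finset.le_sup' (fun S : Finset Ω => |∑ y ∈ S, g y - ∑ y ∈ S, h y|) (Finset.mem_univ S)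

theorem markov_part {Ω X : Type*} [DecidableEq Ω] [MeasurableSpace X]
    (ν : Measure X) [IsProbabilityMeasure ν] (U : Finset Ω) (hU : U.Nonempty)
    (F : Ω → Set X) (hF : ∀ y, MeasurableSet (F y)) (K : ℕ) (hK : 0 < K)
    (hs : ∀ᵐ p ∂ν, ∑ y ∈ U, (F y).indicator (fun _ => (1 : ℝ)) p ≤ K)
    (hreg : ∀ y ∈ U, ∀ y' ∈ U, ν (F y) = ν (F y'))
    (g : Ω → ℝ) (hg0 : ∀ y, 0 ≤ g y) (δ : ℝ) (hδ : 0 < δ) :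
    1 - δ ≤ ν.real {p | ∑ y ∈ U, g y * (F y).indicator (fun _ => (1 : ℝ)) p
      ≤ K * (1 / (δ * U.card)) * ∑ y ∈ U, g y} := by
  have hn : (0 : ℝ) < U.card := by exact_mod_cast hU.card_pos
  have hKr : (0 : ℝ) < K := by exact_mod_cast hK
  have hint : ∀ y, Integrable ((F y).indicator (fun _ => (1 : ℝ))) ν := fun y =>
    (integrable_const (1 : ℝ)).indicator (hF y)
  have hI : ∀ y, ∫ p, (F y).indicator (fun _ => (1 : ℝ)) p ∂ν = ν.real (F y) := fun y => by
    rw [integral_indicator_const _ (hF y)]; simp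
  obtain ⟨y0, hy0⟩ := hU
  have hq : ∀ y ∈ U, ν.real (F y) = ν.real (F y0) := fun y hy => by
    simp only [Measure.real, hreg y hy y0 hy0]
  have hqK : U.card * ν.real (F y0) ≤ K := by
    have h1 : ∫ p, ∑ y ∈ U, (F y).indicator (fun _ => (1 : ℝ)) p ∂ν ≤ ∫ _p, (K : ℝ) ∂ν :=
      integral_mono_ae (integrable_finsetSum _ fun y _ => hint y) (integrable_const _) hs
    rw [integral_finsetSum _ fun y _ => hint y] at h1
    simp only [hI] at h1
    rw [Finset.sum_congr rfl hq] at h1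
    simpa using h1
  set G := ∑ y ∈ U, g y with hG
  set f : X → ℝ := fun p => ∑ y ∈ U, g y * (F y).indicator (fun _ => (1 : ℝ)) p with hf
  have hind : ∀ y p, 0 ≤ (F y).indicator (fun _ => (1 : ℝ)) p := fun y p =>
    Set.indicator_nonneg (fun _ _ => zero_le_one) p
  have hf0 : ∀ p, 0 ≤ f p := fun p =>
    Finset.sum_nonneg fun y _ => mul_nonneg (hg0 y) (hind y p)
  have hfint : Integrable f ν := integrable_finsetSum _ fun y _ => (hint y).const_mul _
  have hfI : ∫ p, f p ∂ν = G * ν.real (F y0) := by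
    rw [hf, integral_finsetSum _ fun y _ => (hint y).const_mul _, hG, Finset.sum_mul]
    refine Finset.sum_congr rfl fun y hy => ?_
    rw [integral_const_mul, hI, hq y hy]
  have hfm : Measurable f := Finset.measurable_fun_sum _ fun y _ =>
    (measurable_const.indicator (hF y)).const_mul _
  have hG0 : 0 ≤ G := Finset.sum_nonneg fun y _ => hg0 y
  have hM : MeasurableSet {p | f p ≤ K * (1 / (δ * U.card)) * G} :=
    measurableSet_le hfm measurable_const
  rcases hG0.eq_or_lt with h0 | hpos
  · have hall : {p | f p ≤ K * (1 / (δ * U.card)) * G} = Set.univ := by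
      ext p
      have hz : ∀ y ∈ U, g y = 0 :=
        (Finset.sum_eq_zero_iff_of_nonneg fun y _ => hg0 y).1 h0.symm
      have : f p = 0 := Finset.sum_eq_zero fun y hy => by rw [hz y hy, zero_mul]
      simp [this, ← h0]
    rw [hall]; simp; linarith
  · have hmk := mul_meas_ge_le_integral_of_nonneg (μ := ν) (Filter.Eventually.of_forall hf0) hfint
      (K * (1 / (δ * U.card)) * G)
    rw [hfI] at hmk
    have hc : ν.real {p | f p ≤ K * (1 / (δ * U.card)) * G}ᶜ
        ≤ ν.real {p | K * (1 / (δ * U.card)) * G ≤ f p} := by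
      refine measureReal_mono ?_
      intro p hp
      simp only [Set.mem_compl_iff, Set.mem_ofPred_eq, not_le] at hp ⊢
      exact hp.le
    rw [probReal_compl_eq_one_sub hM] at hc
    set m := ν.real {p | K * (1 / (δ * U.card)) * G ≤ f p}
    have hm : m ≤ δ := by
      have e : K * (1 / (δ * U.card)) * G * m = (K * G / U.card) * (m / δ) := by
        field_simp
      have h2 : G * ν.real (F y0) ≤ K * G / U.card := by
        rw [le_div_iff₀ hn]; nlinarith
      have h3 : (K * G / U.card) * (m / δ) ≤ (K * G / U.card) * 1 := by
        rw [← e]; change _ * m ≤ _ at hmk; linarith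
      have h4 := le_of_mul_le_mul_left h3 (by positivity)
      rwa [div_le_one hδ] at h4
    linarith

/-- **Missing-mass lower bound from the Markov-style bound.**
`ν` is a Borel probability measure on the simplex `Δ(Ω)` of probability
distributions on the finite nonempty set `Ω`; for `p ∈ Δ(Ω)`,
`F(p) := {y : p(y) > 0}` and `H(p) := Ω \ F(p)`.  Assume ν-a.s. `|F(p)| ≤ K`
and `O ⊆ F(p)`, Regular Facts, and `U := Oᶜ` nonempty.  `Π` is a measurable
assignment of a partition (given by its cell map) to each `p`.  Then for every
`δ ∈ (K/|U|, 1)`: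
`ν({p : g(H(p)) ≥ p(U)/(K+1) − 1/(δ·|U|) − ‖g − p^{Π(p)}‖_TV}) ≥ 1 − δ`. -/
theorem missing_mass_markov_bound
    {Ω : Type*} [Fintype Ω] [DecidableEq Ω] [Nonempty Ω]
    [MeasurableSpace (Finset Ω)] [MeasurableSingletonClass (Finset Ω)]
    (O : Finset Ω) (hU : (Oᶜ : Finset Ω).Nonempty)
    (ν : Measure {p : Ω → ℝ // (∀ y, 0 ≤ p y) ∧ ∑ y, p y = 1})
    [IsProbabilityMeasure ν]
    (K : ℕ) (hK : 0 < K)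
    (hsparse : ∀ᵐ p ∂ν, (Finset.univ.filter fun y => 0 < p.1 y).card ≤ K)
    (hO : ∀ᵐ p ∂ν, ∀ y ∈ O, 0 < p.1 y)
    (hreg : ∀ y ∈ (Oᶜ : Finset Ω), ∀ y' ∈ (Oᶜ : Finset Ω),
      ν {p | 0 < p.1 y} = ν {p | 0 < p.1 y'})
    (part : {p : Ω → ℝ // (∀ y, 0 ≤ p y) ∧ ∑ y, p y = 1} → Ω → Finset Ω)
    (hmem : ∀ p y, y ∈ part p y)
    (hcell : ∀ p y z, z ∈ part p y → part p z = part p y)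
    (hmeas : Measurable part)
    (g : Ω → ℝ) (hg0 : ∀ y, 0 ≤ g y) (hg1 : ∑ y, g y = 1)
    (δ : ℝ) (hδ₁ : (K : ℝ) / (Oᶜ : Finset Ω).card < δ) (hδ₂ : δ < 1) :
    (1 : ℝ) - δ ≤
      (ν {p | (∑ y ∈ Oᶜ, p.1 y) / ((K : ℝ) + 1)
          - 1 / (δ * (Oᶜ : Finset Ω).card)
          - tvDist g (fun y => (∑ z ∈ part p y, p.1 z) / (part p y).card)
        ≤ ∑ y ∈ (Finset.univ.filter fun y => 0 < p.1 y)ᶜ, g y}).toReal := by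
  have hn : (0 : ℝ) < (Oᶜ : Finset Ω).card := by exact_mod_cast hU.card_pos
  have hKr : (0 : ℝ) < K := by exact_mod_cast hK
  have hδ : 0 < δ := lt_trans (by positivity) hδ₁
  have hOK : O.card ≤ K := by
    obtain ⟨p, h1, h2⟩ := (hsparse.and hO).exists
    refine le_trans (Finset.card_le_card fun y hy => ?_) h1
    simpa using h2 y hy
  have hmain := markov_part ν Oᶜ hU (fun y => {p | 0 < p.1 y})
    (fun y => measurableSet_lt measurable_const
      ((measurable_pi_apply y).comp measurable_subtype_coe)) K hK
    (by
      filter_upwards [hsparse] with p hp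
      have h1 : ∑ y ∈ Oᶜ, ({p : {p : Ω → ℝ // (∀ y, 0 ≤ p y) ∧ ∑ y, p y = 1} |
          0 < p.1 y}).indicator (fun _ => (1 : ℝ)) p
          = ((Oᶜ.filter fun y => 0 < p.1 y).card : ℝ) := by
        simp [Set.indicator_apply]
      rw [h1]
      exact_mod_cast (Finset.card_le_card
        (Finset.filter_subset_filter _ (Finset.subset_univ _))).trans hp)
    hreg g hg0 δ hδ
  refine hmain.trans ?_
  refine ENNReal.toReal_mono (measure_ne_top _ _) (measure_mono_ae ?_)
  filter_upwards [hO] with p hp hgood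
  change ∑ y ∈ Oᶜ, g y * _ ≤ _ at hgood
  change _ ≤ _
  have hlow := coarse_lower O K hOK p.1 p.2.1 (part p) (hmem p) (hcell p)
  have htv := tv_ge g (fun y => (∑ z ∈ part p y, p.1 z) / (part p y).card) Oᶜ
  set T := tvDist g (fun y => (∑ z ∈ part p y, p.1 z) / (part p y).card)
  have hT0 : 0 ≤ T := (abs_nonneg _).trans htv
  have htv' := (abs_le.1 htv).1
  have hsplit : ∑ y ∈ Oᶜ, g y = ∑ y ∈ Oᶜ, g y * ({p : {p : Ω → ℝ // (∀ y, 0 ≤ p y) ∧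
      ∑ y, p y = 1} | 0 < p.1 y}).indicator (fun _ => (1 : ℝ)) p
      + ∑ y ∈ (Finset.univ.filter fun y => 0 < p.1 y)ᶜ, g y := by
    have e : (Finset.univ.filter fun y => 0 < p.1 y)ᶜ = Oᶜ.filter fun y => ¬ 0 < p.1 y := by
      ext y
      simp only [Finset.mem_compl, Finset.mem_filter, Finset.mem_univ, true_and]
      exact ⟨fun h => ⟨fun ho => h (hp y ho), h⟩, fun h => h.2⟩
    rw [e, ← Finset.sum_filter_add_sum_filter_not Oᶜ (fun y => 0 < p.1 y) g]
    congr 1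
    simp [Set.indicator_apply, Finset.sum_filter]
  have hP1 : ∑ y ∈ Oᶜ, p.1 y ≤ 1 := by
    refine le_trans ?_ p.2.2.le
    exact Finset.sum_le_sum_of_subset_of_nonneg (Finset.subset_univ _) fun y _ _ => p.2.1 y
  set e := 1 / (δ * ((Oᶜ : Finset Ω).card : ℝ)) with he
  have he0 : 0 ≤ e := by positivity
  have hr : K * e ≤ 1 := by
    rw [div_lt_iff₀ hn] at hδ₁
    rw [he, mul_one_div, div_le_one (by positivity)]
    exact hδ₁.le
  set GU := ∑ y ∈ Oᶜ, g y
  set GH := ∑ y ∈ (Finset.univ.filter fun y => 0 < p.1 y)ᶜ, g y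
  set P := ∑ y ∈ Oᶜ, p.1 y
  set HU := ∑ y ∈ Oᶜ, (∑ z ∈ part p y, p.1 z) / ((part p y).card : ℝ)
  have h1 : (1 - K * e) * GU ≤ GH := by linarith
  have h2 : (1 - K * e) * (P / (K + 1)) ≤ (1 - K * e) * (GU + T) :=
    mul_le_mul_of_nonneg_left (by linarith) (by linarith)
  have h3 : K * e * (P / (K + 1)) ≤ e := by
    have : K * (P / ((K : ℝ) + 1)) ≤ 1 := by
      rw [← mul_div_assoc, div_le_one (by positivity)]
      nlinarith
    nlinarith
  have h4 : 0 ≤ K * e * T := by positivity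
  linarith
end

section
/- Let p be a probability distribution on Ω with |supp(p)| ≤ K and O ⊆ supp(p), and let Π be a partition of Ω. Then p^Π(U) ≥ p(U)/(K+1). (Coarsening preserves a 1/(K+1)-fraction of the missing mass.) -/
/-- **Coarsening preserves a `1/(K+1)`-fraction of the missing mass.**
Let `p` be a probability distribution on the finite nonempty set `Ω` with
`|supp(p)| ≤ K` and `O ⊆ supp(p)`, and let a partition of `Ω` be given by its
cell map `part`.  Then the coarsening `p^Π(y) := p(B_y)/|B_y|` satisfies
`p^Π(U) ≥ p(U)/(K+1)` where `U := Oᶜ`. -/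
theorem coarsening_preserves_missing_mass
    {Ω : Type*} [Fintype Ω] [DecidableEq Ω] [Nonempty Ω]
    (O : Finset Ω) (K : ℕ) (hK : 0 < K)
    (p : Ω → ℝ) (hp0 : ∀ y, 0 ≤ p y) (hp1 : ∑ y, p y = 1)
    (hsupp : (Finset.univ.filter fun y => 0 < p y).card ≤ K)
    (hO : O ⊆ Finset.univ.filter fun y => 0 < p y)
    (part : Ω → Finset Ω)
    (hmem : ∀ y, y ∈ part y)
    (hcell : ∀ y z, z ∈ part y → part z = part y) :
    (∑ y ∈ Oᶜ, p y) / ((K : ℝ) + 1) ≤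
      ∑ y ∈ Oᶜ, (∑ z ∈ part y, p z) / (part y).card := by
  have hsymm : ∀ y z, z ∈ part y ↔ y ∈ part z := by
    intro y z
    constructor
    · intro h
      rw [hcell y z h]; exact hmem y
    · intro h
      rw [hcell z y h]; exact hmem z
  have hOK : O.card ≤ K := (Finset.card_le_card hO).trans hsupp
  have key : ∑ y ∈ Oᶜ, (∑ z ∈ part y, p z) / ((part y).card : ℝ)
      = ∑ z, ∑ y ∈ Oᶜ, if y ∈ part z then p z / ((part z).card : ℝ) else 0 := by
    rw [Finset.sum_comm]
    refine Finset.sum_congr rfl fun y _ => ?_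
    rw [Finset.sum_div, ← Finset.sum_filter]
    have hf : (Finset.univ.filter fun z => y ∈ part z) = part y := by
      ext z
      simp [hsymm y z]
    rw [hf]
    refine Finset.sum_congr rfl fun z hz => ?_
    rw [hcell y z hz]
  rw [key, Finset.sum_div]
  have hnn : ∀ z, 0 ≤ ∑ y ∈ Oᶜ, if y ∈ part z then p z / ((part z).card : ℝ) else 0 := by
    intro z
    refine Finset.sum_nonneg fun y _ => ?_
    split_ifs
    · exact div_nonneg (hp0 z) (Nat.cast_nonneg _)
    · exact le_rfl
  refine le_trans (Finset.sum_le_sum fun z hz => ?_)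
    (Finset.sum_le_sum_of_subset_of_nonneg (Finset.subset_univ Oᶜ) fun z _ _ => hnn z)
  rw [← Finset.sum_filter, Finset.sum_const, nsmul_eq_mul]
  set u := (Oᶜ.filter fun y => y ∈ part z).card with hu
  have hu1 : 1 ≤ u := Finset.card_pos.mpr ⟨z, Finset.mem_filter.mpr ⟨hz, hmem z⟩⟩
  have hc : (part z).card ≤ u + O.card := by
    refine (Finset.card_le_card ?_).trans (Finset.card_union_le _ _)
    intro y hy
    by_cases h : y ∈ O <;> simp [h, hy]
  have hn : (part z).card ≤ u * (K + 1) := by nlinarith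
  have hpos : 0 < (part z).card := Finset.card_pos.mpr ⟨z, hmem z⟩
  have hn' : ((part z).card : ℝ) ≤ u * (K + 1) := by exact_mod_cast hn
  have hpos' : (0 : ℝ) < (part z).card := by exact_mod_cast hpos
  rw [← mul_div_assoc, div_le_div_iff₀ (by positivity) hpos']
  nlinarith [mul_le_mul_of_nonneg_left hn' (hp0 z)]
end

section
/- Let p be a probability distribution on Ω with |supp(p)| ≤ K and O ⊆ supp(p), let Π be a partition of Ω, and let B be any cell of Π. Then p^Π(U ∩ B) ≥ p(U ∩ B)/(K+1). (Cell-wise coarsening inequality.) -/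
/-- **Cell-wise coarsening inequality.**
Let `p` be a probability distribution on the finite nonempty set `Ω` with
`|supp(p)| ≤ K` and `O ⊆ supp(p)`, let a partition of `Ω` be given by its cell
map `part`, and let `B` be any cell of the partition (the cell of some `y₀`).
Then the coarsening `p^Π(y) := p(B_y)/|B_y|` satisfies
`p^Π(U ∩ B) ≥ p(U ∩ B)/(K+1)` where `U := Oᶜ`. -/
theorem cellwise_coarsening_inequality
    {Ω : Type*} [Fintype Ω] [DecidableEq Ω] [Nonempty Ω]
    (O : Finset Ω) (K : ℕ) (hK : 0 < K)
    (p : Ω → ℝ) (hp0 : ∀ y, 0 ≤ p y) (hp1 : ∑ y, p y = 1)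
    (hsupp : (Finset.univ.filter fun y => 0 < p y).card ≤ K)
    (hO : O ⊆ Finset.univ.filter fun y => 0 < p y)
    (part : Ω → Finset Ω)
    (hmem : ∀ y, y ∈ part y)
    (hcell : ∀ y z, z ∈ part y → part z = part y)
    (B : Finset Ω) (y₀ : Ω) (hB : B = part y₀) :
    (∑ y ∈ Oᶜ ∩ B, p y) / ((K : ℝ) + 1) ≤
      ∑ y ∈ Oᶜ ∩ B, (∑ z ∈ part y, p z) / (part y).card := by
  have hpart : ∀ y ∈ Oᶜ ∩ B, part y = B := by
    intro y hy
    rw [hB] at hy ⊢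
    exact hcell y₀ y (Finset.mem_inter.mp hy).2
  have hR : ∑ y ∈ Oᶜ ∩ B, (∑ z ∈ part y, p z) / ((part y).card : ℝ)
      = ((Oᶜ ∩ B).card : ℝ) * ((∑ z ∈ B, p z) / (B.card : ℝ)) := by
    rw [← nsmul_eq_mul, ← Finset.sum_const]
    refine Finset.sum_congr rfl fun y hy => ?_
    rw [hpart y hy]
  rw [hR]
  have hsub : ∑ y ∈ Oᶜ ∩ B, p y ≤ ∑ y ∈ B, p y :=
    Finset.sum_le_sum_of_subset_of_nonneg Finset.inter_subset_right fun y _ _ => hp0 y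
  have hS : 0 ≤ ∑ y ∈ Oᶜ ∩ B, p y := Finset.sum_nonneg fun y _ => hp0 y
  rcases (Oᶜ ∩ B).eq_empty_or_nonempty with h | h
  · simp [h]
  have hBpos : 0 < B.card := Finset.card_pos.mpr (h.mono Finset.inter_subset_right)
  have h1 : 1 ≤ (Oᶜ ∩ B).card := Finset.card_pos.mpr h
  have hOK : O.card ≤ K := (Finset.card_le_card hO).trans hsupp
  have h2 : B.card ≤ (Oᶜ ∩ B).card + O.card := by
    refine (Finset.card_le_card (fun y hy => ?_)).trans (Finset.card_union_le (Oᶜ ∩ B) O)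
    by_cases hyO : y ∈ O <;> simp [hy, hyO]
  have h3 : B.card ≤ (Oᶜ ∩ B).card * (K + 1) := by nlinarith
  have h3' : (B.card : ℝ) ≤ ((Oᶜ ∩ B).card : ℝ) * ((K : ℝ) + 1) := by exact_mod_cast h3
  have hBpos' : (0 : ℝ) < B.card := by exact_mod_cast hBpos
  rw [← mul_div_assoc, div_le_div_iff₀ (by positivity) hBpos']
  calc (∑ y ∈ Oᶜ ∩ B, p y) * (B.card : ℝ)
      ≤ (∑ y ∈ B, p y) * (((Oᶜ ∩ B).card : ℝ) * ((K : ℝ) + 1)) :=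
        mul_le_mul hsub h3' hBpos'.le (hS.trans hsub)
    _ = _ := by ring
end

section
/- Assume K-sparsity and r-Regular Facts, that ν-almost surely O ⊆ F, and that U is nonempty. Then for every δ with rK/|U| < δ < 1: ν({F ⊆ Ω : g(Ω \ F) ≥ g(U)·(1 − rK/(δ·|U|))}) ≥ 1 − δ. (Markov-style bound under r-Regular Facts.) -/
open MeasureTheory

/-- **Markov-style bound under `r`-Regular Facts.**
Under `K`-sparsity and `r`-Regular Facts (for every `y ∈ U := Oᶜ`,
`ν({F : y ∈ F}) ≤ r · 𝔼_ν[|F ∩ U|]/|U|`, `r ≥ 1`), with `O ⊆ F` ν-a.s. and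
`U` nonempty, for every `δ ∈ (rK/|U|, 1)`:
`ν({F : g(Ω \ F) ≥ g(U)·(1 − rK/(δ·|U|))}) ≥ 1 − δ`. -/
theorem markov_style_bound_r_regular
    {Ω : Type*} [Fintype Ω] [DecidableEq Ω] [Nonempty Ω]
    [MeasurableSpace (Finset Ω)] [MeasurableSingletonClass (Finset Ω)]
    (O : Finset Ω) (hU : (Oᶜ : Finset Ω).Nonempty)
    (ν : Measure (Finset Ω)) [IsProbabilityMeasure ν]
    (K : ℕ) (hK : 0 < K) (r : ℝ) (hr : 1 ≤ r)
    (hsparse : ∀ᵐ F ∂ν, F.card ≤ K)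
    (hO : ∀ᵐ F ∂ν, O ⊆ F)
    (hreg : ∀ y ∈ (Oᶜ : Finset Ω),
      (ν {F | y ∈ F}).toReal ≤
        r * (∫ F, ((F ∩ Oᶜ).card : ℝ) ∂ν) / (Oᶜ : Finset Ω).card)
    (g : Ω → ℝ) (hg0 : ∀ y, 0 ≤ g y) (hg1 : ∑ y, g y = 1)
    (δ : ℝ) (hδ₁ : r * K / (Oᶜ : Finset Ω).card < δ) (hδ₂ : δ < 1) :
    (1 : ℝ) - δ ≤
      (ν {F | (∑ y ∈ Oᶜ, g y) * (1 - r * K / (δ * (Oᶜ : Finset Ω).card)) ≤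
        ∑ y ∈ Fᶜ, g y}).toReal := by
  have hn : (0 : ℝ) < ((Oᶜ : Finset Ω).card : ℝ) := by exact_mod_cast hU.card_pos
  have hK' : (0 : ℝ) < (K : ℝ) := by exact_mod_cast hK
  have hr0 : 0 < r := by linarith
  set n : ℝ := ((Oᶜ : Finset Ω).card : ℝ) with hn_def
  have hc : 0 < r * K / n := by positivity
  have hδ : 0 < δ := hc.trans hδ₁
  set G : ℝ := ∑ y ∈ Oᶜ, g y with hG
  have hG0 : 0 ≤ G := Finset.sum_nonneg fun y _ => hg0 y
  set c : ℝ := r * K / n with hc_def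
  have hcd : r * K / (δ * n) = c / δ := by rw [hc_def]; field_simp
  rw [hcd]
  have hint : (∫ F, ((F ∩ Oᶜ).card : ℝ) ∂ν) ≤ K := by
    have h := integral_mono_ae (μ := ν) (f := fun F : Finset Ω => ((F ∩ Oᶜ).card : ℝ))
      (g := fun _ => (K : ℝ)) Integrable.of_finite Integrable.of_finite (by
        filter_upwards [hsparse] with F hF
        exact_mod_cast (Finset.card_le_card Finset.inter_subset_left).trans hF)
    simpa using h
  have hreg' : ∀ y ∈ (Oᶜ : Finset Ω), ν.real {F | y ∈ F} ≤ c := by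
    intro y hy
    refine (hreg y hy).trans ?_
    rw [hc_def]
    gcongr
  let X : Finset Ω → ℝ := fun F => ∑ y ∈ Oᶜ, ({F : Finset Ω | y ∈ F}).indicator (fun _ => g y) F
  have hX0 : ∀ F, 0 ≤ X F := fun F =>
    Finset.sum_nonneg fun y _ => Set.indicator_nonneg (fun _ _ => hg0 y) F
  have hEX : ∫ F, X F ∂ν ≤ G * c := by
    simp only [X]
    rw [integral_finsetSum _ (fun _ _ => Integrable.of_finite), hG, Finset.sum_mul]
    refine Finset.sum_le_sum fun y hy => ?_
    rw [integral_indicator_const _ (Set.toFinite _).measurableSet, smul_eq_mul, mul_comm]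
    exact mul_le_mul_of_nonneg_left (hreg' y hy) (hg0 y)
  have hXF : ∀ F : Finset Ω, G ≤ X F + ∑ y ∈ Fᶜ, g y := by
    intro F
    have h1 : ∑ y ∈ Fᶜ, g y = ∑ y, if y ∈ F then 0 else g y := by
      rw [← Finset.sum_compl_add_sum F (fun y => if y ∈ F then 0 else g y),
        Finset.sum_eq_zero (s := F) (fun y hy => if_pos hy), add_zero]
      exact Finset.sum_congr rfl fun y hy => (if_neg (Finset.mem_compl.mp hy)).symm
    have h2 : ∑ y ∈ Oᶜ, (if y ∈ F then 0 else g y) ≤ ∑ y, if y ∈ F then 0 else g y :=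
      Finset.sum_le_sum_of_subset_of_nonneg (Finset.subset_univ _) (by
        intro y _ _
        split_ifs
        · exact le_rfl
        · exact hg0 y)
    have h3 : G = X F + ∑ y ∈ Oᶜ, (if y ∈ F then 0 else g y) := by
      simp only [X, hG, ← Finset.sum_add_distrib]
      refine Finset.sum_congr rfl fun y _ => ?_
      by_cases h : y ∈ F <;> simp [h]
    rw [h1]; linarith
  change 1 - δ ≤ ν.real _
  rcases hG0.eq_or_lt with h0 | hpos
  · rw [← h0]
    have : {F : Finset Ω | 0 * (1 - c / δ) ≤ ∑ y ∈ Fᶜ, g y} = Set.univ := by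
      ext F
      simpa using Finset.sum_nonneg fun y _ => hg0 y
    rw [this]
    simp
    exact hδ.le
  · have hM := mul_meas_ge_le_integral_of_nonneg (μ := ν) (f := X)
      (Filter.Eventually.of_forall hX0) Integrable.of_finite (G * (c / δ))
    have hb : ν.real {F | G * (c / δ) ≤ X F} ≤ δ := by
      have h1 : 0 < G * (c / δ) := by positivity
      have h2 : G * c = G * (c / δ) * δ := by field_simp
      have h3 := hM.trans hEX
      rw [h2] at h3
      exact le_of_mul_le_mul_left h3 h1
    set A := {F : Finset Ω | G * (1 - c / δ) ≤ ∑ y ∈ Fᶜ, g y} with hA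
    have hsub : Aᶜ ⊆ {F | G * (c / δ) ≤ X F} := by
      intro F hF
      simp only [hA, Set.mem_compl_iff, Set.mem_setOf_eq, not_le] at hF ⊢
      have := hXF F
      linarith
    have h4 := measureReal_mono (μ := ν) hsub
    rw [probReal_compl_eq_one_sub (Set.toFinite _).measurableSet] at h4
    linarith
end

section
/- Assume K-sparsity and r-Regular Facts, and suppose U is nonempty. Then ν({F ⊆ Ω : g(Ω \ F) ≥ g(U)/(K+1)}) ≥ 1 − rK/|U|. (High-confidence bound under r-Regular Facts.) -/
open MeasureTheory

/-- **High-confidence bound under `r`-Regular Facts.**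
Under `K`-sparsity and `r`-Regular Facts (for every `y ∈ U := Oᶜ`,
`ν({F : y ∈ F}) ≤ r · 𝔼_ν[|F ∩ U|]/|U|`, `r ≥ 1`), with `U` nonempty:
`ν({F : g(Ω \ F) ≥ g(U)/(K+1)}) ≥ 1 − rK/|U|`. -/
theorem high_confidence_bound_r_regular
    {Ω : Type*} [Fintype Ω] [DecidableEq Ω] [Nonempty Ω]
    [MeasurableSpace (Finset Ω)] [MeasurableSingletonClass (Finset Ω)]
    (O : Finset Ω) (hU : (Oᶜ : Finset Ω).Nonempty)
    (ν : Measure (Finset Ω)) [IsProbabilityMeasure ν]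
    (K : ℕ) (hK : 0 < K) (r : ℝ) (hr : 1 ≤ r)
    (hsparse : ∀ᵐ F ∂ν, F.card ≤ K)
    (hreg : ∀ y ∈ (Oᶜ : Finset Ω),
      (ν {F | y ∈ F}).toReal ≤
        r * (∫ F, ((F ∩ Oᶜ).card : ℝ) ∂ν) / (Oᶜ : Finset Ω).card)
    (g : Ω → ℝ) (hg0 : ∀ y, 0 ≤ g y) (hg1 : ∑ y, g y = 1) :
    (1 : ℝ) - r * K / (Oᶜ : Finset Ω).card ≤
      (ν {F | (∑ y ∈ Oᶜ, g y) / ((K : ℝ) + 1) ≤ ∑ y ∈ Fᶜ, g y}).toReal := by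
  obtain ⟨m, hm, hmax⟩ := Finset.exists_max_image Oᶜ g hU
  have hcard : (0 : ℝ) < ((Oᶜ : Finset Ω).card : ℝ) := by exact_mod_cast hU.card_pos
  have hmeas : ∀ s : Set (Finset Ω), MeasurableSet s := fun s => s.toFinite.measurableSet
  have hE : (∫ F, ((F ∩ Oᶜ).card : ℝ) ∂ν) ≤ K := by
    have h : (∫ F, ((F ∩ Oᶜ).card : ℝ) ∂ν) ≤ ∫ _F : Finset Ω, (K : ℝ) ∂ν := by
      apply integral_mono_ae Integrable.of_finite (integrable_const _)
      filter_upwards [hsparse] with F hF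
      exact_mod_cast (Finset.card_le_card Finset.inter_subset_left).trans hF
    simpa using h
  have h1 : (ν {F | m ∈ F}).toReal ≤ r * K / (Oᶜ : Finset Ω).card := by
    refine (hreg m hm).trans ?_
    gcongr
  have h2 : (ν {F | m ∈ F}ᶜ).toReal = 1 - (ν {F | m ∈ F}).toReal :=
    probReal_compl_eq_one_sub (hmeas _)
  have h3 : ν {F | m ∈ F}ᶜ ≤
      ν {F | (∑ y ∈ Oᶜ, g y) / ((K : ℝ) + 1) ≤ ∑ y ∈ Fᶜ, g y} := by
    apply measure_mono_ae
    filter_upwards [hsparse] with F hF hmF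
    replace hmF : m ∉ F := hmF
    change (∑ y ∈ Oᶜ, g y) / ((K : ℝ) + 1) ≤ ∑ y ∈ Fᶜ, g y
    have e1 : g m ≤ ∑ y ∈ Fᶜ, g y :=
      Finset.single_le_sum (fun y _ => hg0 y) (Finset.mem_compl.2 hmF)
    have e2 : ∑ y ∈ Oᶜ ∩ F, g y ≤ K * g m := by
      have := Finset.sum_le_card_nsmul (Oᶜ ∩ F) g (g m)
        (fun y hy => hmax y (Finset.mem_inter.1 hy).1)
      rw [nsmul_eq_mul] at this
      refine this.trans (mul_le_mul_of_nonneg_right ?_ (hg0 m))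
      exact_mod_cast (Finset.card_le_card Finset.inter_subset_right).trans hF
    have e3 : ∑ y ∈ Oᶜ \ F, g y ≤ ∑ y ∈ Fᶜ, g y := by
      apply Finset.sum_le_sum_of_subset_of_nonneg
      · intro y hy
        exact Finset.mem_compl.2 (Finset.mem_sdiff.1 hy).2
      · intro y _ _
        exact hg0 y
    have e4 := Finset.sum_inter_add_sum_sdiff Oᶜ F g
    have e5 : (K : ℝ) * g m ≤ K * ∑ y ∈ Fᶜ, g y := by gcongr
    rw [div_le_iff₀ (by positivity)]
    linarith
  have h4 := ENNReal.toReal_mono (measure_ne_top ν _) h3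
  linarith
end

section
/- Assume K-sparsity and Regular Facts, that ν-almost surely O ⊆ F, and that U is nonempty. Then 𝔼_ν[g(F ∩ U)] ≤ g(U)·K/|U|, and consequently 𝔼_ν[g(Ω \ F)] ≥ g(U)·(1 − K/|U|). (Expected hallucination rate is at least the innovation rate up to a sparsity correction.) -/
open MeasureTheory

/-- **Expected hallucination rate is at least the innovation rate up to a
sparsity correction.** Under `K`-sparsity and Regular Facts, with `O ⊆ F`
ν-a.s. and `U := Oᶜ` nonempty: `𝔼_ν[g(F ∩ U)] ≤ g(U)·K/|U|` and consequently
`𝔼_ν[g(Ω \ F)] ≥ g(U)·(1 − K/|U|)`. -/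
theorem expected_hallucination_rate_bound
    {Ω : Type*} [Fintype Ω] [DecidableEq Ω] [Nonempty Ω]
    [MeasurableSpace (Finset Ω)] [MeasurableSingletonClass (Finset Ω)]
    (O : Finset Ω) (hU : (Oᶜ : Finset Ω).Nonempty)
    (ν : Measure (Finset Ω)) [IsProbabilityMeasure ν]
    (K : ℕ) (hK : 0 < K)
    (hsparse : ∀ᵐ F ∂ν, F.card ≤ K)
    (hO : ∀ᵐ F ∂ν, O ⊆ F)
    (hreg : ∀ y ∈ (Oᶜ : Finset Ω), ∀ y' ∈ (Oᶜ : Finset Ω),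
      ν {F | y ∈ F} = ν {F | y' ∈ F})
    (g : Ω → ℝ) (hg0 : ∀ y, 0 ≤ g y) (hg1 : ∑ y, g y = 1) :
    (∫ F, (∑ y ∈ F ∩ Oᶜ, g y) ∂ν) ≤ (∑ y ∈ Oᶜ, g y) * (K : ℝ) / (Oᶜ : Finset Ω).card ∧
    (∑ y ∈ Oᶜ, g y) * (1 - (K : ℝ) / (Oᶜ : Finset Ω).card) ≤
      ∫ F, (∑ y ∈ Fᶜ, g y) ∂ν := by
  have key : ∀ h : Ω → ℝ, (∫ F, (∑ y ∈ F ∩ Oᶜ, h y) ∂ν) =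
      ∑ y ∈ Oᶜ, h y * ν.real {F | y ∈ F} := by
    intro h
    have h1 : ∀ F : Finset Ω, (∑ y ∈ F ∩ Oᶜ, h y) =
        ∑ y ∈ Oᶜ, Set.indicator {F : Finset Ω | y ∈ F} (fun _ => h y) F := by
      intro F
      rw [Finset.inter_comm, ← Finset.filter_mem_eq_inter, Finset.sum_filter]
      refine Finset.sum_congr rfl fun y _ => ?_
      simp [Set.indicator_apply]
    simp_rw [h1]
    rw [integral_finsetSum _ (fun y _ => Integrable.of_finite)]
    refine Finset.sum_congr rfl fun y _ => ?_
    rw [integral_indicator_const _ (Set.toFinite _).measurableSet, smul_eq_mul, mul_comm]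
  obtain ⟨u, hu⟩ := hU
  have hreg' : ∀ y ∈ (Oᶜ : Finset Ω), ν.real {F | y ∈ F} = ν.real {F | u ∈ F} := by
    intro y hy
    simp only [Measure.real, hreg y hy u hu]
  have key2 : ∀ h : Ω → ℝ, (∫ F, (∑ y ∈ F ∩ Oᶜ, h y) ∂ν) =
      (∑ y ∈ Oᶜ, h y) * ν.real {F | u ∈ F} := by
    intro h
    rw [key, Finset.sum_mul]
    exact Finset.sum_congr rfl fun y hy => by rw [hreg' y hy]
  have hcpos : (0 : ℝ) < (Oᶜ : Finset Ω).card := by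
    exact_mod_cast Finset.card_pos.mpr ⟨u, hu⟩
  have hp : ((Oᶜ : Finset Ω).card : ℝ) * ν.real {F | u ∈ F} ≤ K := by
    have h1 := key2 (fun _ => 1)
    have h2 : (∫ F, (∑ y ∈ F ∩ Oᶜ, (1 : ℝ)) ∂ν) ≤ ∫ _F, (K : ℝ) ∂ν := by
      refine integral_mono_ae Integrable.of_finite Integrable.of_finite ?_
      filter_upwards [hsparse] with F hF
      have : (F ∩ Oᶜ).card ≤ K := (Finset.card_le_card Finset.inter_subset_left).trans hF
      simpa using this
    rw [h1] at h2
    simpa using h2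
  have hgU : 0 ≤ ∑ y ∈ Oᶜ, g y := Finset.sum_nonneg fun y _ => hg0 y
  have first : (∫ F, (∑ y ∈ F ∩ Oᶜ, g y) ∂ν) ≤
      (∑ y ∈ Oᶜ, g y) * (K : ℝ) / (Oᶜ : Finset Ω).card := by
    rw [key2, mul_div_assoc]
    refine mul_le_mul_of_nonneg_left ?_ hgU
    rw [le_div_iff₀ hcpos]
    linarith
  refine ⟨first, ?_⟩
  have h3 : (∫ F, ((∑ y ∈ Oᶜ, g y) - ∑ y ∈ F ∩ Oᶜ, g y) ∂ν) ≤ ∫ F, (∑ y ∈ Fᶜ, g y) ∂ν := by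
    refine integral_mono Integrable.of_finite Integrable.of_finite fun F => ?_
    have h4 : (∑ y ∈ Oᶜ, g y) ≤ ∑ y ∈ Fᶜ ∪ (F ∩ Oᶜ), g y := by
      refine Finset.sum_le_sum_of_subset_of_nonneg ?_ fun y _ _ => hg0 y
      intro y hy
      by_cases hF : y ∈ F <;> simp_all
    rw [Finset.sum_union] at h4
    · simp only
      linarith
    · rw [Finset.disjoint_left]
      intro y hy
      simp_all
  rw [integral_sub Integrable.of_finite Integrable.of_finite] at h3
  simp only [integral_const, probReal_univ, one_smul] at h3
  rw [mul_sub, mul_one, ← mul_div_assoc]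
  linarith
end

section
/- Assume K-sparsity and r-Regular Facts, that ν-almost surely O ⊆ F, and that U is nonempty. Then 𝔼_ν[g(F ∩ U)] ≤ r·g(U)·K/|U|, and consequently 𝔼_ν[g(Ω \ F)] ≥ g(U)·(1 − rK/|U|). (Expected hallucination rate under r-Regular Facts.) -/
open MeasureTheory

/-- **Expected hallucination rate under `r`-Regular Facts.**
Under `K`-sparsity and `r`-Regular Facts (for every `y ∈ U := Oᶜ`,
`ν({F : y ∈ F}) ≤ r · 𝔼_ν[|F ∩ U|]/|U|`, `r ≥ 1`), with `O ⊆ F` ν-a.s. and `U`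
nonempty: `𝔼_ν[g(F ∩ U)] ≤ r·g(U)·K/|U|` and consequently
`𝔼_ν[g(Ω \ F)] ≥ g(U)·(1 − rK/|U|)`. -/
theorem expected_hallucination_rate_r_regular
    {Ω : Type*} [Fintype Ω] [DecidableEq Ω] [Nonempty Ω]
    [MeasurableSpace (Finset Ω)] [MeasurableSingletonClass (Finset Ω)]
    (O : Finset Ω) (hU : (Oᶜ : Finset Ω).Nonempty)
    (ν : Measure (Finset Ω)) [IsProbabilityMeasure ν]
    (K : ℕ) (hK : 0 < K) (r : ℝ) (hr : 1 ≤ r)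
    (hsparse : ∀ᵐ F ∂ν, F.card ≤ K)
    (hO : ∀ᵐ F ∂ν, O ⊆ F)
    (hreg : ∀ y ∈ (Oᶜ : Finset Ω),
      (ν {F | y ∈ F}).toReal ≤
        r * (∫ F, ((F ∩ Oᶜ).card : ℝ) ∂ν) / (Oᶜ : Finset Ω).card)
    (g : Ω → ℝ) (hg0 : ∀ y, 0 ≤ g y) (hg1 : ∑ y, g y = 1) :
    (∫ F, (∑ y ∈ F ∩ Oᶜ, g y) ∂ν) ≤
      r * (∑ y ∈ Oᶜ, g y) * (K : ℝ) / (Oᶜ : Finset Ω).card ∧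
    (∑ y ∈ Oᶜ, g y) * (1 - r * (K : ℝ) / (Oᶜ : Finset Ω).card) ≤
      ∫ F, (∑ y ∈ Fᶜ, g y) ∂ν := by
  have hint : ∀ f : Finset Ω → ℝ, Integrable f ν := fun f => Integrable.of_finite
  have hc : (0 : ℝ) < ((Oᶜ : Finset Ω).card : ℝ) := by exact_mod_cast hU.card_pos
  have hE : (∫ F, ((F ∩ Oᶜ).card : ℝ) ∂ν) ≤ K := by
    have h : (∫ F, ((F ∩ Oᶜ).card : ℝ) ∂ν) ≤ ∫ _F, (K : ℝ) ∂ν := by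
      refine integral_mono_ae (hint _) (hint _) ?_
      filter_upwards [hsparse] with F hF
      exact_mod_cast (Finset.card_le_card Finset.inter_subset_left).trans hF
    simpa using h
  have h1 : (∫ F, (∑ y ∈ F ∩ Oᶜ, g y) ∂ν) ≤
      r * (∑ y ∈ Oᶜ, g y) * (K : ℝ) / (Oᶜ : Finset Ω).card := by
    have e : ∀ F : Finset Ω, (∑ y ∈ F ∩ Oᶜ, g y) =
        ∑ y ∈ Oᶜ, Set.indicator {F : Finset Ω | y ∈ F} (fun _ => g y) F := by
      intro F
      rw [Finset.inter_comm, ← Finset.filter_mem_eq_inter, Finset.sum_filter]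
      simp [Set.indicator_apply]
    simp_rw [e]
    rw [integral_finsetSum _ (fun y _ => hint _)]
    have e2 : r * (∑ y ∈ Oᶜ, g y) * (K : ℝ) / (Oᶜ : Finset Ω).card =
        ∑ y ∈ Oᶜ, (r * K / (Oᶜ : Finset Ω).card) * g y := by
      rw [← Finset.mul_sum]; ring
    rw [e2]
    refine Finset.sum_le_sum fun y hy => ?_
    rw [integral_indicator_const _ (Set.toFinite _).measurableSet, smul_eq_mul]
    refine mul_le_mul_of_nonneg_right ((hreg y hy).trans ?_) (hg0 y)
    gcongr
  refine ⟨h1, ?_⟩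
  have h2 : (∫ F, ((∑ y ∈ Oᶜ, g y) - ∑ y ∈ F ∩ Oᶜ, g y) ∂ν) ≤
      ∫ F, (∑ y ∈ Fᶜ, g y) ∂ν := by
    refine integral_mono (hint _) (hint _) fun F => ?_
    have h3 : (∑ y ∈ Oᶜ, g y) ≤ ∑ y ∈ Fᶜ ∪ (F ∩ Oᶜ), g y := by
      refine Finset.sum_le_sum_of_subset_of_nonneg (fun y hy => ?_) (fun y _ _ => hg0 y)
      by_cases h : y ∈ F <;> simp_all
    have h4 := Finset.sum_union_inter (s₁ := Fᶜ) (s₂ := F ∩ Oᶜ) (f := g)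
    have h5 : 0 ≤ ∑ y ∈ Fᶜ ∩ (F ∩ Oᶜ), g y := Finset.sum_nonneg fun y _ => hg0 y
    show (∑ y ∈ Oᶜ, g y) - ∑ y ∈ F ∩ Oᶜ, g y ≤ ∑ y ∈ Fᶜ, g y
    linarith
  rw [integral_sub (hint _) (hint _)] at h2
  simp only [integral_const, probReal_univ, one_smul] at h2
  have e3 : (∑ y ∈ Oᶜ, g y) * (1 - r * (K : ℝ) / (Oᶜ : Finset Ω).card) =
      (∑ y ∈ Oᶜ, g y) - r * (∑ y ∈ Oᶜ, g y) * (K : ℝ) / (Oᶜ : Finset Ω).card := by ring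
  rw [e3]
  linarith
end

section
/- Assume ν-almost surely |F(p)| ≤ K and O ⊆ F(p), assume r-Regular Facts (for every y ∈ U, ν({p : y ∈ F(p)}) ≤ r · 𝔼_ν[|F(p) ∩ U|]/|U|, with r ≥ 1), and suppose U is nonempty. Let Π be a measurable assignment p ↦ Π(p) of a partition of Ω to each distribution p. Then for every δ with rK/|U| < δ < 1: ν({p : g(H(p)) ≥ p(U)/(K+1) − r/(δ·|U|) − ‖g − p^{Π(p)}‖_TV}) ≥ 1 − δ. (Missing-mass Markov-style bound under r-Regular Facts.) -/
open MeasureTheory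

lemma aux_coarse {Ω : Type*} [Fintype Ω] [DecidableEq Ω] (O : Finset Ω) (p : Ω → ℝ)
    (hp : ∀ y, 0 ≤ p y) (B : Ω → Finset Ω) (hmem : ∀ y, y ∈ B y)
    (hcell : ∀ y z, z ∈ B y → B z = B y) :
    (∑ y ∈ Oᶜ, p y) / ((O.card : ℝ) + 1) ≤ ∑ y ∈ Oᶜ, (∑ z ∈ B y, p z) / (B y).card := by
  have hsym : ∀ y z, z ∈ B y ↔ y ∈ B z := fun y z =>
    ⟨fun h => by rw [hcell y z h]; exact hmem y, fun h => by rw [hcell z y h]; exact hmem z⟩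
  have h1 : ∑ y ∈ Oᶜ, (∑ z ∈ B y, p z) / ((B y).card : ℝ)
      = ∑ z, p z * (((Oᶜ ∩ B z).card : ℝ) / (B z).card) := by
    have : ∀ y, (∑ z ∈ B y, p z) / ((B y).card : ℝ)
        = ∑ z, if y ∈ B z then p z / (B z).card else 0 := by
      intro y
      rw [Finset.sum_div, ← Finset.sum_filter]
      have : (Finset.univ.filter fun z => y ∈ B z) = B y := by
        ext z; simp [hsym y z]
      rw [this]
      refine Finset.sum_congr rfl fun z hz => ?_
      rw [hcell y z hz]
    simp_rw [this]
    rw [Finset.sum_comm]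
    refine Finset.sum_congr rfl fun z _ => ?_
    rw [← Finset.sum_filter, Finset.sum_const, nsmul_eq_mul, Finset.filter_mem_eq_inter]
    ring
  rw [h1, Finset.sum_div]
  refine le_trans (Finset.sum_le_sum fun z hz => ?_)
    (Finset.sum_le_sum_of_subset_of_nonneg (Finset.subset_univ Oᶜ)
      fun z _ _ => mul_nonneg (hp z) (by positivity))
  rw [div_eq_mul_one_div]
  refine mul_le_mul_of_nonneg_left ?_ (hp z)
  have hb : 0 < (B z).card := Finset.card_pos.mpr ⟨z, hmem z⟩
  have hu : 0 < (Oᶜ ∩ B z).card := Finset.card_pos.mpr ⟨z, Finset.mem_inter.mpr ⟨hz, hmem z⟩⟩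
  have hle : (B z).card ≤ (Oᶜ ∩ B z).card + O.card := by
    refine le_trans (Finset.card_le_card ?_) (Finset.card_union_le _ _)
    intro y hy
    by_cases h : y ∈ O <;> simp [h, hy]
  have hle2 : (B z).card ≤ (Oᶜ ∩ B z).card * (O.card + 1) := by nlinarith
  rw [div_le_div_iff₀ (by positivity) (by exact_mod_cast hb)]
  rw [one_mul]
  exact_mod_cast hle2

lemma aux_arith (a K θ P Q G GH t : ℝ) (ha : 0 ≤ a) (haK : a ≤ K) (hK : 0 < K) (hθ : K < θ)
    (hP0 : 0 ≤ P) (hP1 : P ≤ 1) (ht : 0 ≤ t) (hQ : P / (a + 1) ≤ Q) (hG : Q - t ≤ G)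
    (hH : G - (K - a) * G / θ ≤ GH) :
    P / (K + 1) - 1 / θ - t ≤ GH := by
  have hθ0 : 0 < θ := by linarith
  set c := 1 - (K - a) / θ with hc
  have hc0 : 0 ≤ c := by
    rw [hc, sub_nonneg, div_le_one hθ0]; linarith
  have hc1 : c ≤ 1 := by
    rw [hc]; have : 0 ≤ (K - a) / θ := div_nonneg (by linarith) hθ0.le
    linarith
  have h1 : c * G ≤ GH := by
    refine le_trans (le_of_eq ?_) hH
    rw [hc]; ring
  have h2 : c * (P / (a + 1) - t) ≤ c * G := mul_le_mul_of_nonneg_left (by linarith) hc0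
  have h3 : c * t ≤ t := by nlinarith
  have h4 : 1 / (K + 1) - 1 / θ ≤ c / (a + 1) := by
    have e : c / (a + 1) - (1 / (K + 1) - 1 / θ)
        = (θ * (K - a) - (K - 2 * a - 1) * (K + 1)) / (θ * (a + 1) * (K + 1)) := by
      rw [hc]; field_simp; ring
    have : 0 ≤ c / (a + 1) - (1 / (K + 1) - 1 / θ) := by
      rw [e]
      apply div_nonneg _ (by positivity)
      nlinarith [mul_nonneg (sub_nonneg.mpr hθ.le) (sub_nonneg.mpr haK), mul_nonneg ha hK.le]
    linarith
  have h5 : P * (1 / (K + 1) - 1 / θ) ≤ P * (c / (a + 1)) := mul_le_mul_of_nonneg_left h4 hP0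
  have h6 : P * (1 / θ) ≤ 1 / θ := by
    have : 0 < 1 / θ := by positivity
    nlinarith
  have e1 : P / (K + 1) = P * (1 / (K + 1)) := by ring
  have e2 : c * (P / (a + 1) - t) = P * (c / (a + 1)) - c * t := by ring
  rw [e1]
  linarith

/-- **Missing-mass Markov-style bound under `r`-Regular Facts.**
`ν` is a Borel probability measure on the simplex `Δ(Ω)` of probability
distributions on the finite nonempty set `Ω`; for `p ∈ Δ(Ω)`,
`F(p) := {y : p(y) > 0}` and `H(p) := Ω \ F(p)`.  Assume ν-a.s. `|F(p)| ≤ K`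
and `O ⊆ F(p)`, `r`-Regular Facts (for every `y ∈ U := Oᶜ`,
`ν({p : y ∈ F(p)}) ≤ r·𝔼_ν[|F(p) ∩ U|]/|U|`, `r ≥ 1`), and `U` nonempty.  `Π`
is a measurable assignment of a partition (given by its cell map) to each `p`.
Then for every `δ ∈ (rK/|U|, 1)`:
`ν({p : g(H(p)) ≥ p(U)/(K+1) − r/(δ·|U|) − ‖g − p^{Π(p)}‖_TV}) ≥ 1 − δ`. -/
theorem missing_mass_markov_bound_r_regular
    {Ω : Type*} [Fintype Ω] [DecidableEq Ω] [Nonempty Ω]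
    [MeasurableSpace (Finset Ω)] [MeasurableSingletonClass (Finset Ω)]
    (O : Finset Ω) (hU : (Oᶜ : Finset Ω).Nonempty)
    (ν : Measure {p : Ω → ℝ // (∀ y, 0 ≤ p y) ∧ ∑ y, p y = 1})
    [IsProbabilityMeasure ν]
    (K : ℕ) (hK : 0 < K) (r : ℝ) (hr : 1 ≤ r)
    (hsparse : ∀ᵐ p ∂ν, (Finset.univ.filter fun y => 0 < p.1 y).card ≤ K)
    (hO : ∀ᵐ p ∂ν, ∀ y ∈ O, 0 < p.1 y)
    (hreg : ∀ y ∈ (Oᶜ : Finset Ω),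
      (ν {p | 0 < p.1 y}).toReal ≤
        r * (∫ p, (((Finset.univ.filter fun y => 0 < p.1 y) ∩ Oᶜ).card : ℝ) ∂ν)
          / (Oᶜ : Finset Ω).card)
    (part : {p : Ω → ℝ // (∀ y, 0 ≤ p y) ∧ ∑ y, p y = 1} → Ω → Finset Ω)
    (hmem : ∀ p y, y ∈ part p y)
    (hcell : ∀ p y z, z ∈ part p y → part p z = part p y)
    (hmeas : Measurable part)
    (g : Ω → ℝ) (hg0 : ∀ y, 0 ≤ g y) (hg1 : ∑ y, g y = 1)
    (δ : ℝ) (hδ₁ : r * K / (Oᶜ : Finset Ω).card < δ) (hδ₂ : δ < 1) :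
    (1 : ℝ) - δ ≤
      (ν {p | (∑ y ∈ Oᶜ, p.1 y) / ((K : ℝ) + 1)
          - r / (δ * (Oᶜ : Finset Ω).card)
          - tvDist g (fun y => (∑ z ∈ part p y, p.1 z) / (part p y).card)
        ≤ ∑ y ∈ (Finset.univ.filter fun y => 0 < p.1 y)ᶜ, g y}).toReal := by
  classical
  have hUc : (0 : ℝ) < (Oᶜ : Finset Ω).card := by exact_mod_cast Finset.card_pos.mpr hU
  set N : ℝ := ((Oᶜ : Finset Ω).card : ℝ) with hN
  have hK' : (0 : ℝ) < K := by exact_mod_cast hK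
  have hr0 : 0 < r := by linarith
  have hδ0 : 0 < δ := lt_of_le_of_lt (by positivity) hδ₁
  have hcards : ∀ᵐ p ∂ν,
      (((Finset.univ.filter fun y => 0 < p.1 y) ∩ Oᶜ).card : ℝ) ≤ (K : ℝ) - O.card := by
    filter_upwards [hsparse, hO] with p h1 h2
    have hsub : O ⊆ Finset.univ.filter fun y => 0 < p.1 y := by
      intro y hy; simpa using h2 y hy
    have h3 : ((Finset.univ.filter fun y => 0 < p.1 y) ∩ Oᶜ).card + O.card ≤ K := by
      rw [← Finset.sdiff_eq_inter_compl, Finset.card_sdiff_add_card_eq_card hsub]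
      exact h1
    have : (((Finset.univ.filter fun y => 0 < p.1 y) ∩ Oᶜ).card : ℝ) + O.card ≤ K := by
      exact_mod_cast h3
    linarith
  have haK : (O.card : ℝ) ≤ K := by
    obtain ⟨p, hp⟩ := hcards.exists
    have : (0 : ℝ) ≤ (((Finset.univ.filter fun y => 0 < p.1 y) ∩ Oᶜ).card : ℝ) := by positivity
    linarith
  set a : ℝ := (O.card : ℝ) with ha
  have hm : (∫ p, (((Finset.univ.filter fun y => 0 < p.1 y) ∩ Oᶜ).card : ℝ) ∂ν) ≤ K - a := by
    have := integral_mono_of_nonneg (μ := ν)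
      (f := fun p => (((Finset.univ.filter fun y => 0 < p.1 y) ∩ Oᶜ).card : ℝ))
      (g := fun _ => (K : ℝ) - a)
      (Filter.Eventually.of_forall fun p => by simp) (integrable_const _) hcards
    simpa using this
  have hms : ∀ y, MeasurableSet
      {p : {p : Ω → ℝ // (∀ y, 0 ≤ p y) ∧ ∑ y, p y = 1} | 0 < p.1 y} := fun y =>
    measurableSet_lt measurable_const ((measurable_pi_apply y).comp measurable_subtype_coe)
  set X : {p : Ω → ℝ // (∀ y, 0 ≤ p y) ∧ ∑ y, p y = 1} → ℝ :=
    fun p => ∑ y ∈ Oᶜ, ({p | 0 < p.1 y} : Set _).indicator (fun _ => g y) p with hX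
  have hXint : ∀ y, Integrable (({p : {p : Ω → ℝ // (∀ y, 0 ≤ p y) ∧ ∑ y, p y = 1} |
      0 < p.1 y} : Set _).indicator (fun _ => g y)) ν := fun y =>
    (integrable_const _).indicator (hms y)
  have hXi : Integrable X ν := integrable_finsetSum _ fun y _ => hXint y
  have hX0 : ∀ p, 0 ≤ X p := fun p =>
    Finset.sum_nonneg fun y _ => Set.indicator_nonneg (fun _ _ => hg0 y) p
  have hXm : Measurable X :=
    Finset.measurable_sum _ fun y _ => measurable_const.indicator (hms y)
  set G : ℝ := ∑ y ∈ Oᶜ, g y with hG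
  have hG0 : 0 ≤ G := Finset.sum_nonneg fun y _ => hg0 y
  have hEX : ∫ p, X p ∂ν ≤ r * (K - a) / N * G := by
    rw [hX, integral_finsetSum _ fun y _ => hXint y, hG, Finset.mul_sum]
    refine Finset.sum_le_sum fun y hy => ?_
    rw [integral_indicator_const _ (hms y), smul_eq_mul]
    refine mul_le_mul_of_nonneg_right ?_ (hg0 y)
    refine le_trans (hreg y hy) ?_
    gcongr
  set θ : ℝ := δ * N / r with hθ
  have hθK : (K : ℝ) < θ := by
    rw [div_lt_iff₀ hUc] at hδ₁
    rw [hθ, lt_div_iff₀ hr0]; linarith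
  have hθ0 : 0 < θ := by linarith
  set ε : ℝ := (K - a) * G / θ with hε
  have hε0 : 0 ≤ ε := div_nonneg (mul_nonneg (by linarith) hG0) hθ0.le
  have hEX2 : ∫ p, X p ∂ν ≤ δ * ε := by
    refine le_trans hEX (le_of_eq ?_)
    rw [hε, hθ]; field_simp
  have hbad : ν.real {p | ε < X p} ≤ δ := by
    rcases hε0.eq_or_lt with h | h
    · have hz : ∫ p, X p ∂ν = 0 := le_antisymm (by rw [← h] at hEX2; simpa using hEX2)
        (integral_nonneg hX0)
      rw [integral_eq_zero_iff_of_nonneg hX0 hXi] at hz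
      have : ν {p | ε < X p} = 0 := by
        rw [← h]
        refine measure_mono_null ?_ (ae_iff.mp hz)
        intro p hp
        exact ne_of_gt hp
      rw [measureReal_def, this]; simpa using hδ0.le
    · have h1 := mul_meas_ge_le_integral_of_nonneg (Filter.Eventually.of_forall hX0) hXi ε
      have h2 : ν.real {p | ε < X p} ≤ ν.real {p | ε ≤ X p} :=
        by
        refine measureReal_mono (fun p hp => ?_)
        have h5 : ε < X p := hp
        exact (show ε ≤ X p from h5.le)
      have h3 : ε * ν.real {p | ε ≤ X p} ≤ ε * δ := by
        rw [mul_comm ε δ]; exact le_trans h1 hEX2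
      exact h2.trans (le_of_mul_le_mul_left h3 h)
  have hgood : 1 - δ ≤ ν.real {p | ε < X p}ᶜ := by
    rw [probReal_compl_eq_one_sub (measurableSet_lt measurable_const hXm)]
    linarith
  refine le_trans hgood ?_
  rw [measureReal_def]
  refine ENNReal.toReal_mono (measure_ne_top _ _) (measure_mono_ae ?_)
  filter_upwards [hO] with p hOp hp
  have hXp : X p ≤ ε := not_lt.mp hp
  show (∑ y ∈ Oᶜ, p.1 y) / ((K : ℝ) + 1) - r / (δ * N)
      - tvDist g (fun y => (∑ z ∈ part p y, p.1 z) / (part p y).card)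
        ≤ ∑ y ∈ (Finset.univ.filter fun y => 0 < p.1 y)ᶜ, g y
  have htv : ∀ S : Finset Ω, |∑ y ∈ S, g y - ∑ y ∈ S, (∑ z ∈ part p y, p.1 z) / (part p y).card|
      ≤ tvDist g (fun y => (∑ z ∈ part p y, p.1 z) / (part p y).card) := fun S =>
    Finset.le_sup' (fun S : Finset Ω =>
      |∑ y ∈ S, g y - ∑ y ∈ S, (∑ z ∈ part p y, p.1 z) / ((part p y).card : ℝ)|)
      (Finset.mem_univ S)
  have e : r / (δ * N) = 1 / θ := by rw [hθ]; field_simp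
  rw [e]
  refine aux_arith a K θ _ _ G _ _ (by positivity) haK hK' hθK
    (Finset.sum_nonneg fun y _ => p.2.1 y) ?_ (le_trans (abs_nonneg _) (htv ∅))
    (aux_coarse O p.1 p.2.1 (part p) (hmem p) (hcell p)) ?_ ?_
  · refine le_trans ?_ p.2.2.le
    exact Finset.sum_le_sum_of_subset_of_nonneg (Finset.subset_univ _) fun y _ _ => p.2.1 y
  · have := (abs_le.mp (htv Oᶜ)).1
    linarith
  · have hs : G - X p = ∑ y ∈ (Finset.univ.filter fun y => 0 < p.1 y)ᶜ, g y := by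
      have hsub : (Finset.univ.filter fun y => 0 < p.1 y)ᶜ ⊆ Oᶜ := by
        intro y hy
        simp only [Finset.mem_compl, Finset.mem_filter, Finset.mem_univ, true_and] at hy ⊢
        exact fun h => hy (hOp y h)
      rw [hG, hX, ← Finset.sum_sub_distrib, ← Finset.sum_subset hsub (f := fun y => g y -
        ({p | 0 < p.1 y} : Set {p : Ω → ℝ // (∀ y, 0 ≤ p y) ∧ ∑ y, p y = 1}).indicator
          (fun _ => g y) p)]
      · refine Finset.sum_congr rfl fun y hy => ?_
        have : ¬ 0 < p.1 y := by simpa using hy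
        simp [Set.indicator, this]
      · intro y _ hy
        have : 0 < p.1 y := by simpa using hy
        simp [Set.indicator, this]
    rw [← hs]
    linarith
end
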